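/- arXiv:2303.16332 — 2 statements merged into one kernel-verified Lean document; each statement's English description precedes it below -/
import Mathlib

section
/- Every positive root β ∈ Φ⁺ admits a positive expression: there exist r ≥ 0 and indices j, i_1, …, i_r with β = s_{i_r}⋯s_{i_1}(α_j) and, for every 1 ≤ k ≤ r, s_{i_k}s_{i_{k−1}}⋯s_{i_1}(α_j) − s_{i_{k−1}}⋯s_{i_1}(α_j) ∈ ℝ_{>0}·α_{i_k}. -/
/-!
Setup: a symmetrizable crystallographic Cartan matrix `A` with symmetrizers `d`,
the vector space `V = Fin n → ℝ` with standard basis `α i = Pi.single i 1`,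
the bilinear form `(α i, α j) = d i * A i j`, the simple reflections
`s i (x) = x - (dᵢ⁻¹ αᵢ, x) αᵢ`, the group `W` generated by them (elements of
which are represented as products of lists of simple reflections), and the
set of real roots `Φ = { w (α i) }`.
-/

open Finset

noncomputable section

/-- The simple root `α i`, i.e. the `i`-th standard basis vector of `ℝⁿ`. -/
def sroot (n : ℕ) (i : Fin n) : Fin n → ℝ := Pi.single i 1

/-- The symmetric bilinear form with `(α i, α j) = d i * A i j`. -/
def formL (n : ℕ) (d : Fin n → ℤ) (A : Fin n → Fin n → ℤ) :
    (Fin n → ℝ) →ₗ[ℝ] (Fin n → ℝ) →ₗ[ℝ] ℝ :=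
  ∑ i : Fin n, ∑ j : Fin n,
    ((d i * A i j : ℤ) : ℝ) •
      LinearMap.smulRight (LinearMap.proj i : (Fin n → ℝ) →ₗ[ℝ] ℝ)
        (LinearMap.proj j : (Fin n → ℝ) →ₗ[ℝ] ℝ)

/-- The simple reflection `s i`, given by `s i x = x - (dᵢ⁻¹ • αᵢ, x) • αᵢ`. -/
def simpleRefl (n : ℕ) (d : Fin n → ℤ) (A : Fin n → Fin n → ℤ) (i : Fin n) :
    Module.End ℝ (Fin n → ℝ) :=
  LinearMap.id - ((d i : ℝ)⁻¹) • (formL n d A (sroot n i)).smulRight (sroot n i)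

/-- The element `s i_r * ⋯ * s i_1` of `W` corresponding to the list `l = [i_1, …, i_r]`
(the reflection `s i_1` is applied first). -/
def wprod (n : ℕ) (d : Fin n → ℤ) (A : Fin n → Fin n → ℤ) (l : List (Fin n)) :
    Module.End ℝ (Fin n → ℝ) :=
  ((l.map (simpleRefl n d A)).reverse).prod

/-- `β` is a real root: `β = w (α i)` for some `w ∈ W` and some `i`. -/
def IsRoot (n : ℕ) (d : Fin n → ℤ) (A : Fin n → Fin n → ℤ) (β : Fin n → ℝ) : Prop :=
  ∃ (l : List (Fin n)) (i : Fin n), β = wprod n d A l (sroot n i)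

/-- `β` is a positive root: a real root all of whose coordinates are `≥ 0`. -/
def IsPosRoot (n : ℕ) (d : Fin n → ℤ) (A : Fin n → Fin n → ℤ) (β : Fin n → ℝ) : Prop :=
  IsRoot n d A β ∧ ∀ k, 0 ≤ β k

/-- `β` is a negative root: a real root all of whose coordinates are `≤ 0`. -/
def IsNegRoot (n : ℕ) (d : Fin n → ℤ) (A : Fin n → Fin n → ℤ) (β : Fin n → ℝ) : Prop :=
  IsRoot n d A β ∧ ∀ k, β k ≤ 0

/-- The reflection `t_β` along a root `β`: `t_β x = x - (β^∨, x) • β` where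
`β^∨ = d_β⁻¹ • β` and `d_β = (β, β)/2`. -/
def reflAlong (n : ℕ) (d : Fin n → ℤ) (A : Fin n → Fin n → ℤ) (β : Fin n → ℝ) :
    Module.End ℝ (Fin n → ℝ) :=
  LinearMap.id - (2 / formL n d A β β) • (formL n d A β).smulRight β

/-- `s i_r ⋯ s i_1 (α j)` (encoded by the list `l = [i_1, …, i_r]` and the index `j`)
is a positive expression: each partial application moves up in the root poset, i.e.
`s i_k ⋯ s i_1 (α j) - s i_{k-1} ⋯ s i_1 (α j) ∈ ℝ_{>0} • α i_k` for all `k`. -/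
def IsPosExpr (n : ℕ) (d : Fin n → ℤ) (A : Fin n → Fin n → ℤ) (j : Fin n)
    (l : List (Fin n)) : Prop :=
  ∀ k : Fin l.length, ∃ c : ℝ, 0 < c ∧
    wprod n d A (l.take (k.1 + 1)) (sroot n j) - wprod n d A (l.take k.1) (sroot n j)
      = c • sroot n (l.get k)

/-- The length `ℓ(w)`: the smallest `r` such that `w` is a product of `r` simple
reflections. -/
def len (n : ℕ) (d : Fin n → ℤ) (A : Fin n → Fin n → ℤ)
    (w : Module.End ℝ (Fin n → ℝ)) : ℕ :=
  sInf {r | ∃ l : List (Fin n), l.length = r ∧ wprod n d A l = w}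

/-- integer pairing with the `i`-th simple coroot -/
def zpr {n : ℕ} (A : Fin n → Fin n → ℤ) (i : Fin n) (v : Fin n → ℤ) : ℤ := ∑ j, A i j * v j

/-- integer simple root -/
def ze {n : ℕ} (i : Fin n) : Fin n → ℤ := Pi.single i 1

/-- integer simple reflection -/
def zs {n : ℕ} (A : Fin n → Fin n → ℤ) (i : Fin n) (v : Fin n → ℤ) : Fin n → ℤ :=
  v - zpr A i v • ze i

/-- height -/
def zht {n : ℕ} (v : Fin n → ℤ) : ℤ := ∑ j, v j

/-- integer vectors with a positive expression -/
inductive ZP {n : ℕ} (A : Fin n → Fin n → ℤ) : (Fin n → ℤ) → Prop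
  | simple (j : Fin n) : ZP A (ze j)
  | up (v : Fin n → ℤ) (i : Fin n) : ZP A v → zpr A i v < 0 → ZP A (zs A i v)

theorem zpr_add {n : ℕ} (A : Fin n → Fin n → ℤ) (i : Fin n) (v w : Fin n → ℤ) :
    zpr A i (v + w) = zpr A i v + zpr A i w := by
  simp [zpr, mul_add, Finset.sum_add_distrib]

theorem zpr_smul {n : ℕ} (A : Fin n → Fin n → ℤ) (i : Fin n) (c : ℤ) (w : Fin n → ℤ) :
    zpr A i (c • w) = c * zpr A i w := by
  simp only [zpr, Finset.mul_sum, Pi.smul_apply, smul_eq_mul]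
  exact Finset.sum_congr rfl fun _ _ => by ring

theorem zpr_sub {n : ℕ} (A : Fin n → Fin n → ℤ) (i : Fin n) (v w : Fin n → ℤ) :
    zpr A i (v - w) = zpr A i v - zpr A i w := by
  simp [zpr, mul_sub, Finset.sum_sub_distrib]

theorem zpr_ze {n : ℕ} (A : Fin n → Fin n → ℤ) (i j : Fin n) :
    zpr A i (ze j) = A i j := by
  simp [zpr, ze, Pi.single_apply]

theorem zht_sub {n : ℕ} (v w : Fin n → ℤ) : zht (v - w) = zht v - zht w := by
  simp [zht, Finset.sum_sub_distrib]

theorem zht_smul_ze {n : ℕ} (c : ℤ) (j : Fin n) : zht (c • (ze j : Fin n → ℤ)) = c := by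
  simp [zht, ze, Pi.single_apply]

theorem zs_zs {n : ℕ} (A : Fin n → Fin n → ℤ) (hdiag : ∀ i, A i i = 2) (i : Fin n)
    (v : Fin n → ℤ) : zs A i (zs A i v) = v := by
  simp only [zs, zpr_sub, zpr_smul, zpr_ze, hdiag]
  module

theorem zs_neg {n : ℕ} (A : Fin n → Fin n → ℤ) (i : Fin n)
    (v : Fin n → ℤ) : zs A i (-v) = - zs A i v := by
  have : zpr A i (-v) = - zpr A i v := by simp [zpr]
  simp only [zs, this]
  module

theorem ZP.nonneg {n : ℕ} {A : Fin n → Fin n → ℤ} {v : Fin n → ℤ} (h : ZP A v) :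
    ∀ k, 0 ≤ v k := by
  induction h with
  | simple j => intro k; by_cases h : k = j <;> simp [ze, Pi.single_apply, h]
  | up v i _ hp ih =>
    intro k
    have := ih k
    by_cases h : k = i
    · subst h; simp [zs, ze]; omega
    · simp [zs, ze, h, this]

theorem ZP.ht_pos {n : ℕ} {A : Fin n → Fin n → ℤ} {v : Fin n → ℤ} (h : ZP A v) :
    0 < zht v := by
  induction h with
  | simple j => simp [zht, ze]
  | up v i _ hp ih => rw [zs, zht_sub, zht_smul_ze]; omega

theorem ZP.prim {n : ℕ} {A : Fin n → Fin n → ℤ} (hdiag : ∀ i, A i i = 2)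
    {v : Fin n → ℤ} (h : ZP A v) :
    ∃ g : (Fin n → ℤ) → ℤ, (∀ (c : ℤ) w, g (c • w) = c * g w) ∧ g v = 1 := by
  induction h with
  | simple j => exact ⟨fun w => w j, by simp, by simp [ze]⟩
  | up v i _ hp ih =>
    obtain ⟨g, h1, h2⟩ := ih
    refine ⟨fun w => g (zs A i w), ?_, by simp only [zs_zs A hdiag, h2]⟩
    intro c w
    have : zs A i (c • w) = c • zs A i w := by
      simp only [zs, zpr_smul]; module
    simp only [this, h1]

theorem ZP.cross {n : ℕ} {A : Fin n → Fin n → ℤ} (hdiag : ∀ i, A i i = 2)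
    {v : Fin n → ℤ} {k : Fin n} (h : ZP A v) (h2 : ZP A (-(zs A k v))) : v = ze k := by
  have e : v = v k • ze k := by
    funext l
    by_cases hl : l = k
    · subst hl; simp [ze]
    · have a := h.nonneg l
      have b := h2.nonneg l
      simp [zs, ze, hl] at b ⊢
      omega
  obtain ⟨g, h1, h3⟩ := h.prim hdiag
  rw [e, h1] at h3
  have h4 := h.nonneg k
  have : v k = 1 := by
    rcases Int.isUnit_iff.1 (IsUnit.of_mul_eq_one _ h3) with h | h <;> omega
  rw [e, this, one_smul]

theorem ZP.upw {n : ℕ} {A : Fin n → Fin n → ℤ}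
    {v : Fin n → ℤ} {k : Fin n} (h : ZP A v) (h2 : zpr A k v ≤ 0) : ZP A (zs A k v) := by
  rcases h2.lt_or_eq with h3 | h3
  · exact ZP.up v k h h3
  · simpa [zs, h3] using h

theorem rank2_bound (a b p q : ℤ) (ha : 0 ≤ a) (hb : 0 ≤ b) (hp : 0 < p) (hq : 0 < q)
    (Q C1 C2 : ℤ → ℤ → Prop) (ht : ℤ) (hht : ∀ x y, Q x y → 0 < ht - x - y)
    (hC1 : ∀ x y, C1 x y → p - 2 * x + a * y = 2 ∧ q - 2 * y + b * x = - b)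
    (hC2 : ∀ x y, C2 x y → p - 2 * x + a * y = - a ∧ q - 2 * y + b * x = 2)
    (D1 : ∀ x y, 0 < x + y → Q x y → Q (x + (p - 2 * x + a * y)) y ∨ C1 x y)
    (D2 : ∀ x y, 0 < x + y → Q x y → Q x (y + (q - 2 * y + b * x)) ∨ C2 x y)
    (h0 : Q 0 q) : a * b < 4 := by
  have key : ∀ N : ℕ, ∀ x y, 0 ≤ x → 0 ≤ y → 0 < x + y → Q x y → ht - x - y ≤ N →
      ∃ x y : ℤ, 0 ≤ x ∧ 0 ≤ y ∧ p - 2 * x + a * y ≤ 0 ∧ q - 2 * y + b * x ≤ 0 := by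
    intro N
    induction N with
    | zero => intro x y _ _ _ h h2; have := hht x y h; push_cast at h2; omega
    | succ N ih =>
      intro x y hx hy hxy h h2
      push_cast at h2
      by_cases c1 : 0 < p - 2 * x + a * y
      · rcases D1 x y hxy h with h3 | h3
        · exact ih _ _ (by omega) hy (by omega) h3 (by omega)
        · have := hC1 x y h3
          exact ⟨x + 1, y, by omega, hy, by linarith, by linarith⟩
      · by_cases c2 : 0 < q - 2 * y + b * x
        · rcases D2 x y hxy h with h3 | h3
          · exact ih _ _ hx (by omega) (by omega) h3 (by omega)
          · have := hC2 x y h3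
            exact ⟨x, y + 1, hx, by omega, by linarith, by linarith⟩
        · exact ⟨x, y, hx, hy, by omega, by omega⟩
  have h1 := hht 0 q h0
  obtain ⟨x, y, hx, hy, e1, e2⟩ := key (ht - 0 - q).toNat 0 q le_rfl hq.le (by omega) h0 (by omega)
  have f1 : 0 ≤ a * y := mul_nonneg ha hy
  have f2 : 0 ≤ b * x := mul_nonneg hb hx
  have hx' : 0 < x := by omega
  have hy' : 0 < y := by omega
  by_contra hc
  have g1 : (a * y) * (b * x) < (2 * x) * (2 * y) :=
    mul_lt_mul'' (by omega) (by omega) f1 f2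
  have g2 : 0 < x * y := mul_pos hx' hy'
  nlinarith

theorem rank2_arith (a b p q : ℤ) (ha : 0 ≤ a) (hb : 0 ≤ b) (hp : 0 < p) (hq : 0 < q)
    (hab : a = 0 ↔ b = 0)
    (Q C1 C2 : ℤ → ℤ → Prop) (ht : ℤ) (hht : ∀ x y, Q x y → 0 < ht - x - y)
    (hC1 : ∀ x y, C1 x y → p - 2 * x + a * y = 2 ∧ q - 2 * y + b * x = - b)
    (hC2 : ∀ x y, C2 x y → p - 2 * x + a * y = - a ∧ q - 2 * y + b * x = 2)
    (D1 : ∀ x y, 0 < x + y → Q x y → Q (x + (p - 2 * x + a * y)) y ∨ C1 x y)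
    (D2 : ∀ x y, 0 < x + y → Q x y → Q x (y + (q - 2 * y + b * x)) ∨ C2 x y)
    (U1 : ∀ x y, Q x y → p - 2 * x + a * y ≤ 0 → Q (x + (p - 2 * x + a * y)) y)
    (U2 : ∀ x y, Q x y → q - 2 * y + b * x ≤ 0 → Q x (y + (q - 2 * y + b * x)))
    (h0 : Q 0 q) : Q p 0 ∨ (p = 1 ∧ q = 1 ∧ C1 0 1) := by
  have hlt := rank2_bound a b p q ha hb hp hq Q C1 C2 ht hht hC1 hC2 D1 D2 h0
  have d1 : ∀ x y x', Q x y → 0 < x + y → x' = x + (p - 2 * x + a * y) → Q x' y ∨ C1 x y := by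
    rintro x y _ h h2 rfl; exact D1 x y h2 h
  have d2 : ∀ x y y', Q x y → 0 < x + y → y' = y + (q - 2 * y + b * x) → Q x y' ∨ C2 x y := by
    rintro x y _ h h2 rfl; exact D2 x y h2 h
  have u1 : ∀ x y x', Q x y → p - 2 * x + a * y ≤ 0 → x' = x + (p - 2 * x + a * y) → Q x' y := by
    rintro x y _ h h2 rfl; exact U1 x y h h2
  have u2 : ∀ x y y', Q x y → q - 2 * y + b * x ≤ 0 → y' = y + (q - 2 * y + b * x) → Q x y' := by
    rintro x y _ h h2 rfl; exact U2 x y h h2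
  have cases6 : (a = 0 ∧ b = 0) ∨ (a = 1 ∧ b = 1) ∨ (a = 1 ∧ b = 2) ∨ (a = 2 ∧ b = 1) ∨
      (a = 1 ∧ b = 3) ∨ (a = 3 ∧ b = 1) := by
    by_cases h : a = 0
    · exact Or.inl ⟨h, hab.1 h⟩
    · have h' : b ≠ 0 := fun hh => h (hab.2 hh)
      have : 1 ≤ a := by omega
      have : 1 ≤ b := by omega
      have : a ≤ 3 := by nlinarith
      have : b ≤ 3 := by nlinarith
      interval_cases a <;> interval_cases b <;> omega
  rcases cases6 with ⟨rfl, rfl⟩ | ⟨rfl, rfl⟩ | ⟨rfl, rfl⟩ | ⟨rfl, rfl⟩ | ⟨rfl, rfl⟩ | ⟨rfl, rfl⟩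
  · rcases d1 0 q p h0 (by omega) (by omega) with h1 | h1
    · exact Or.inl (u2 p q 0 h1 (by omega) (by omega))
    · have := hC1 _ _ h1; omega
  · rcases d1 0 q (p + q) h0 (by omega) (by omega) with h1 | h1
    · rcases d2 (p + q) q (p + q) h1 (by omega) (by omega) with h2 | h2
      · have h3 := u1 _ _ p h2 (by omega) (by omega)
        exact Or.inl (u2 _ _ 0 h3 (by omega) (by omega))
      · have := hC2 _ _ h2; omega
    · have := hC1 _ _ h1
      have e : q = 1 := by omega
      subst e
      exact Or.inr ⟨by omega, rfl, h1⟩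
  all_goals left
  · rcases d1 0 q (p + q) h0 (by omega) (by omega) with h1 | h1
    on_goal 2 => have := hC1 _ _ h1; omega
    rcases d2 _ _ (2 * p + 2 * q) h1 (by omega) (by omega) with h2 | h2
    on_goal 2 => have := hC2 _ _ h2; omega
    rcases d1 _ _ (2 * p + q) h2 (by omega) (by omega) with h3 | h3
    on_goal 2 => have := hC1 _ _ h3; omega
    have h4 := u2 _ _ (2 * p + q) h3 (by omega) (by omega)
    have h5 := u1 _ _ p h4 (by omega) (by omega)
    exact u2 _ _ 0 h5 (by omega) (by omega)
  · rcases d1 0 q (p + 2 * q) h0 (by omega) (by omega) with h1 | h1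
    on_goal 2 => have := hC1 _ _ h1; omega
    rcases d2 _ _ (p + 2 * q) h1 (by omega) (by omega) with h2 | h2
    on_goal 2 => have := hC2 _ _ h2; omega
    rcases d1 _ _ (2 * p + 2 * q) h2 (by omega) (by omega) with h3 | h3
    on_goal 2 => have := hC1 _ _ h3; omega
    have h4 := u2 _ _ (p + q) h3 (by omega) (by omega)
    have h5 := u1 _ _ p h4 (by omega) (by omega)
    exact u2 _ _ 0 h5 (by omega) (by omega)
  · rcases d1 0 q (p + q) h0 (by omega) (by omega) with h1 | h1
    on_goal 2 => have := hC1 _ _ h1; omega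
    rcases d2 _ _ (3 * p + 3 * q) h1 (by omega) (by omega) with h2 | h2
    on_goal 2 => have := hC2 _ _ h2; omega
    rcases d1 _ _ (3 * p + 2 * q) h2 (by omega) (by omega) with h3 | h3
    on_goal 2 => have := hC1 _ _ h3; omega
    rcases d2 _ _ (6 * p + 4 * q) h3 (by omega) (by omega) with h4 | h4
    on_goal 2 => have := hC2 _ _ h4; omega
    rcases d1 _ _ (4 * p + 2 * q) h4 (by omega) (by omega) with h5 | h5
    on_goal 2 => have := hC1 _ _ h5; omega
    have h6 := u2 _ _ (6 * p + 3 * q) h5 (by omega) (by omega)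
    have h7 := u1 _ _ (3 * p + q) h6 (by omega) (by omega)
    have h8 := u2 _ _ (3 * p + q) h7 (by omega) (by omega)
    have h9 := u1 _ _ p h8 (by omega) (by omega)
    exact u2 _ _ 0 h9 (by omega) (by omega)
  · rcases d1 0 q (p + 3 * q) h0 (by omega) (by omega) with h1 | h1
    on_goal 2 => have := hC1 _ _ h1; omega
    rcases d2 _ _ (p + 3 * q) h1 (by omega) (by omega) with h2 | h2
    on_goal 2 => have := hC2 _ _ h2; omega
    rcases d1 _ _ (3 * p + 6 * q) h2 (by omega) (by omega) with h3 | h3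
    on_goal 2 => have := hC1 _ _ h3; omega
    rcases d2 _ _ (2 * p + 4 * q) h3 (by omega) (by omega) with h4 | h4
    on_goal 2 => have := hC2 _ _ h4; omega
    rcases d1 _ _ (4 * p + 6 * q) h4 (by omega) (by omega) with h5 | h5
    on_goal 2 => have := hC1 _ _ h5; omega
    have h6 := u2 _ _ (2 * p + 3 * q) h5 (by omega) (by omega)
    have h7 := u1 _ _ (3 * p + 3 * q) h6 (by omega) (by omega)
    have h8 := u2 _ _ (p + q) h7 (by omega) (by omega)
    have h9 := u1 _ _ p h8 (by omega) (by omega)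
    exact u2 _ _ 0 h9 (by omega) (by omega)

theorem ZP.coh {n : ℕ} (A : Fin n → Fin n → ℤ) (hdiag : ∀ i, A i i = 2)
    (hoff : ∀ i j, i ≠ j → A i j ≤ 0) (hz : ∀ i j, A i j = 0 → A j i = 0) :
    ∀ (N : ℕ) (v : Fin n → ℤ), ZP A v → zht v ≤ N → ∀ i, ZP A (zs A i v) ∨ ZP A (-(zs A i v)) := by
  intro N
  induction N with
  | zero => intro v hv h; have := hv.ht_pos; push_cast at h; omega
  | succ N ih =>
    intro v hv hN i
    push_cast at hN
    by_cases hp : zpr A i v ≤ 0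
    · exact Or.inl (hv.upw hp)
    push Not at hp
    have hv' := hv
    cases hv with
    | simple j =>
      rw [zpr_ze] at hp
      by_cases hij : i = j
      · subst hij
        right
        have : -(zs A i (ze i)) = ze i := by
          simp only [zs, zpr_ze, hdiag]; module
        rw [this]; exact hv'
      · exact absurd (hoff i j hij) (by omega)
    | up w j hw hj =>
      set v := zs A j w with hvdef
      by_cases hij : i = j
      · subst hij; left; rw [hvdef, zs_zs A hdiag]; exact hw
      have hsj : zs A j v = w := by rw [hvdef, zs_zs A hdiag]
      have hq : 0 < zpr A j v := by
        rw [hvdef, zs, zpr_sub, zpr_smul, zpr_ze, hdiag]; omega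
      let vec : ℤ → ℤ → (Fin n → ℤ) := fun x y => v - x • ze i - y • ze j
      have pr1 : ∀ x y, zpr A i (vec x y) = zpr A i v - 2 * x + (-A i j) * y := by
        intro x y; simp only [vec, zpr_sub, zpr_smul, zpr_ze, hdiag]; ring
      have pr2 : ∀ x y, zpr A j (vec x y) = zpr A j v - 2 * y + (-A j i) * x := by
        intro x y; simp only [vec, zpr_sub, zpr_smul, zpr_ze, hdiag]; ring
      have s1 : ∀ x y, zs A i (vec x y) =
          vec (x + (zpr A i v - 2 * x + (-A i j) * y)) y := by
        intro x y; rw [zs, pr1]; simp only [vec]; module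
      have s2 : ∀ x y, zs A j (vec x y) =
          vec x (y + (zpr A j v - 2 * y + (-A j i) * x)) := by
        intro x y; rw [zs, pr2]; simp only [vec]; module
      have hht : ∀ x y, zht (vec x y) = zht v - x - y := by
        intro x y; simp only [vec, zht_sub, zht_smul_ze]
      have v0 : vec 0 0 = v := by simp [vec]
      have main := rank2_arith (-A i j) (-A j i) (zpr A i v) (zpr A j v)
        (by have := hoff i j hij; omega) (by have := hoff j i (Ne.symm hij); omega) hp hq
        (by have h1 := hz i j; have h2 := hz j i; omega)
        (fun x y => ZP A (vec x y)) (fun x y => vec x y = ze i) (fun x y => vec x y = ze j)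
        (zht v) (fun x y h => by rw [← hht]; exact h.ht_pos)
        (fun x y h => by rw [← pr1, ← pr2, h, zpr_ze, zpr_ze, hdiag]; simp)
        (fun x y h => by rw [← pr1, ← pr2, h, zpr_ze, zpr_ze, hdiag]; simp)
        (fun x y hxy h => by
          rcases ih _ h (by rw [hht]; omega) i with h2 | h2
          · left; rw [← s1]; exact h2
          · right; exact h.cross hdiag h2)
        (fun x y hxy h => by
          rcases ih _ h (by rw [hht]; omega) j with h2 | h2
          · left; rw [← s2]; exact h2
          · right; exact h.cross hdiag h2)
        (fun x y h h2 => by rw [← s1]; exact h.upw (by rw [pr1]; exact h2))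
        (fun x y h h2 => by rw [← s2]; exact h.upw (by rw [pr2]; exact h2))
        (by
          have : vec 0 (zpr A j v) = w := by rw [← hsj]; simp [vec, zs]
          simp only [this]; exact hw)
      left
      rcases main with h | ⟨h1, h2, h3⟩
      · have : zs A i v = vec (zpr A i v) 0 := by simp [vec, zs]
        rw [this]; exact h
      · have : zs A i v = ze j := by
          have e : v = ze i + ze j := by
            rw [← h3]; simp only [vec]; module
          rw [zs, h1, e]; module
        rw [this]; exact ZP.simple j

theorem cast_refl {n : ℕ} (d : Fin n → ℤ) (A : Fin n → Fin n → ℤ) (hd : ∀ i, 0 < d i)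
    (i : Fin n) (v : Fin n → ℤ) :
    simpleRefl n d A i (fun k => (v k : ℝ)) = fun k => ((zs A i v k : ℤ) : ℝ) := by
  have hdi : (d i : ℝ) ≠ 0 := by exact_mod_cast (hd i).ne'
  have h : (d i : ℝ)⁻¹ * formL n d A (sroot n i) (fun k => (v k : ℝ)) = (zpr A i v : ℝ) := by
    have : formL n d A (sroot n i) (fun k => (v k : ℝ)) = (d i : ℝ) * (zpr A i v : ℝ) := by
      simp only [formL, sroot, LinearMap.sum_apply, LinearMap.smul_apply,
        LinearMap.smulRight_apply, LinearMap.proj_apply, smul_eq_mul]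
      rw [Finset.sum_eq_single i]
      · simp [zpr, Finset.mul_sum, mul_assoc]
      · intro b _ hb; simp [hb]
      · simp
    rw [this]; field_simp
  funext k
  simp only [simpleRefl, LinearMap.sub_apply, LinearMap.id_apply, LinearMap.smul_apply,
    LinearMap.smulRight_apply, Pi.sub_apply, Pi.smul_apply, smul_eq_mul, zs]
  rw [← mul_assoc, h]
  by_cases hk : k = i <;> simp [sroot, ze, Pi.single_apply, hk]

theorem wprod_append {n : ℕ} (d : Fin n → ℤ) (A : Fin n → Fin n → ℤ) (l : List (Fin n))
    (i : Fin n) (x : Fin n → ℝ) :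
    wprod n d A (l ++ [i]) x = simpleRefl n d A i (wprod n d A l x) := by
  simp [wprod]

theorem cast_ze {n : ℕ} (j : Fin n) : sroot n j = fun k => ((ze j k : ℤ) : ℝ) := by
  funext k
  by_cases hk : k = j <;> simp [sroot, ze, Pi.single_apply, hk]

theorem root_cast {n : ℕ} (d : Fin n → ℤ) (A : Fin n → Fin n → ℤ) (hd : ∀ i, 0 < d i)
    (hdiag : ∀ i, A i i = 2)
    (hoff : ∀ i j, i ≠ j → A i j ≤ 0) (hz : ∀ i j, A i j = 0 → A j i = 0)
    (l : List (Fin n)) (j : Fin n) :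
    ∃ v : Fin n → ℤ, (wprod n d A l (sroot n j) = fun k => ((v k : ℤ) : ℝ)) ∧
      (ZP A v ∨ ZP A (-v)) := by
  induction l using List.reverseRecOn with
  | nil => exact ⟨ze j, by rw [← cast_ze]; simp [wprod], Or.inl (ZP.simple j)⟩
  | append_singleton l i ih =>
    obtain ⟨v, h1, h2⟩ := ih
    refine ⟨zs A i v, by rw [wprod_append, h1, cast_refl d A hd], ?_⟩
    rcases h2 with h | h
    · exact ZP.coh A hdiag hoff hz (zht v).toNat v h (by omega) i
    · have := ZP.coh A hdiag hoff hz (zht (-v)).toNat (-v) h (by omega) i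
      rw [zs_neg, neg_neg] at this
      exact this.symm

theorem ZP.expr {n : ℕ} (d : Fin n → ℤ) (A : Fin n → Fin n → ℤ) (hd : ∀ i, 0 < d i)
    {v : Fin n → ℤ} (h : ZP A v) :
    ∃ (j : Fin n) (l : List (Fin n)),
      IsPosExpr n d A j l ∧ (fun k => ((v k : ℤ) : ℝ)) = wprod n d A l (sroot n j) := by
  induction h with
  | simple j =>
    exact ⟨j, [], fun k => k.elim0, by rw [← cast_ze]; simp [wprod]⟩
  | up v i _ hp ih =>
    obtain ⟨j, l, h1, h2⟩ := ih
    refine ⟨j, l ++ [i], ?_, by rw [wprod_append, ← h2, cast_refl d A hd]⟩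
    rintro ⟨k, hk⟩
    by_cases hkl : k < l.length
    · obtain ⟨c, hc, e⟩ := h1 ⟨k, hkl⟩
      refine ⟨c, hc, ?_⟩
      simp only [List.get_eq_getElem] at e ⊢
      rw [List.take_append_of_le_length (by omega), List.take_append_of_le_length (by omega),
        List.getElem_append_left hkl]
      exact e
    · have hk2 : k = l.length := by simp at hk; omega
      subst hk2
      refine ⟨-(zpr A i v : ℝ), by simpa using hp, ?_⟩
      have t1 : (l ++ [i]).take (l.length + 1) = l ++ [i] := List.take_of_length_le (by simp)
      have t2 : (l ++ [i]).take l.length = l := by simp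
      simp only [t1, t2, wprod_append, ← h2, cast_refl d A hd]
      funext k
      by_cases hk : k = i <;> simp [sroot, ze, zs, Pi.single_apply, hk]

/-- every positive root admits a positive expression. -/
theorem stmt3 (n : ℕ) (hn : 1 ≤ n) (d : Fin n → ℤ) (A : Fin n → Fin n → ℤ)
    (hd : ∀ i, 0 < d i) (hdiag : ∀ i, A i i = 2)
    (hoff : ∀ i j, i ≠ j → A i j ≤ 0)
    (hsym : ∀ i j, d i * A i j = d j * A j i)
    (β : Fin n → ℝ) (hβ : IsPosRoot n d A β) :
    ∃ (j : Fin n) (l : List (Fin n)),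
      IsPosExpr n d A j l ∧ β = wprod n d A l (sroot n j) := by
  have hz : ∀ i j, A i j = 0 → A j i = 0 := by
    intro i j h
    have h1 := hsym i j
    rw [h, mul_zero] at h1
    rcases mul_eq_zero.1 h1.symm with h2 | h2
    · exact absurd h2 (hd j).ne'
    · exact h2
  obtain ⟨⟨l, i, h⟩, hpos⟩ := hβ
  obtain ⟨v, h1, h2⟩ := root_cast d A hd hdiag hoff hz l i
  rw [h1] at h
  rcases h2 with h2 | h2
  · rw [h]; exact ZP.expr d A hd h2
  · exfalso
    have hp := h2.ht_pos
    have : zht (-v) ≤ 0 := by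
      refine Finset.sum_nonpos fun k _ => ?_
      have := hpos k
      simp only [h] at this
      have : 0 ≤ v k := by exact_mod_cast this
      simpa using this
    omega

end
end

section
/- Let β ∈ Φ⁺ be a positive root with a positive expression β = s_{i_r}⋯s_{i_1}(α_j), and set δ_k = s_{i_r}s_{i_{r−1}}⋯s_{i_{k+1}}(α_{i_k}) for 1 ≤ k ≤ r (with δ_r = α_{i_r}). Then for every γ ∈ inv_Φ(t_β) with γ ≠ β, exactly one of the two roots γ and −t_β(γ) occurs in the list {δ_1, δ_2, …, δ_r}. -/
/-!
Setup: a symmetrizable crystallographic Cartan matrix `A` with symmetrizers `d`,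
the vector space `V = Fin n → ℝ` with standard basis `α i = Pi.single i 1`,
the bilinear form `(α i, α j) = d i * A i j`, the simple reflections
`s i (x) = x - (dᵢ⁻¹ αᵢ, x) αᵢ`, the group `W` generated by them (elements of
which are represented as products of lists of simple reflections), and the
set of real roots `Φ = { w (α i) }`.
-/

open Finset

noncomputable section

/-- The inversion set `inv_Φ(t_β)` of the reflection along a positive root `β`:
positive roots sent to negative roots by `t_β`. -/
def invSet (n : ℕ) (d : Fin n → ℤ) (A : Fin n → Fin n → ℤ) (β : Fin n → ℝ) :
    Set (Fin n → ℝ) :=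
  {γ | IsPosRoot n d A γ ∧ IsNegRoot n d A (reflAlong n d A β γ)}

section aux

theorem formL_apply (n : ℕ) (d : Fin n → ℤ) (A : Fin n → Fin n → ℤ) (x y : Fin n → ℝ) :
    formL n d A x y = ∑ i, ∑ j, ((d i : ℝ) * (A i j : ℝ)) * (x i * y j) := by
  simp [formL, LinearMap.sum_apply]

/-- the data of a symmetrizable Cartan matrix -/
structure Car (n : ℕ) (d : Fin n → ℤ) (A : Fin n → Fin n → ℤ) : Prop where
  hd : ∀ i, 0 < d i
  hdiag : ∀ i, A i i = 2
  hoff : ∀ i j, i ≠ j → A i j ≤ 0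
  hsym : ∀ i j, d i * A i j = d j * A j i

variable {n : ℕ} {d : Fin n → ℤ} {A : Fin n → Fin n → ℤ}

theorem form_symm (C : Car n d A) (x y : Fin n → ℝ) : formL n d A x y = formL n d A y x := by
  rw [formL_apply, formL_apply, Finset.sum_comm]
  refine Finset.sum_congr rfl fun i _ => Finset.sum_congr rfl fun j _ => ?_
  have h : (d j : ℝ) * A j i = d i * A i j := by exact_mod_cast C.hsym j i
  rw [h]; ring

theorem form_sroot (i : Fin n) (y : Fin n → ℝ) :
    formL n d A (sroot n i) y = d i * ∑ j, (A i j : ℝ) * y j := by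
  rw [formL_apply, Finset.sum_eq_single i]
  · rw [Finset.mul_sum]
    refine Finset.sum_congr rfl fun j _ => ?_
    simp [sroot]; ring
  · intro b _ hb
    simp [sroot, hb]
  · simp

/-- the pairing with the simple coroot -/
def pr (A : Fin n → Fin n → ℤ) (i : Fin n) : (Fin n → ℝ) →ₗ[ℝ] ℝ :=
  ∑ j, (A i j : ℝ) • LinearMap.proj j

theorem pr_apply (i : Fin n) (y : Fin n → ℝ) : pr A i y = ∑ j, (A i j : ℝ) * y j := by
  simp [pr, LinearMap.sum_apply]

theorem pr_sroot (i j : Fin n) : pr A i (sroot n j) = A i j := by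
  rw [pr_apply]; simp [sroot, Pi.single_apply]

theorem s_apply (C : Car n d A) (i : Fin n) (x : Fin n → ℝ) :
    simpleRefl n d A i x = x - pr A i x • sroot n i := by
  have h : (d i : ℝ) ≠ 0 := by exact_mod_cast (C.hd i).ne'
  simp only [simpleRefl, LinearMap.sub_apply, LinearMap.id_apply, LinearMap.smul_apply,
    LinearMap.smulRight_apply, form_sroot, pr_apply, smul_smul]
  rw [inv_mul_cancel_left₀ h]

theorem form_sroot' (i : Fin n) (y : Fin n → ℝ) :
    formL n d A (sroot n i) y = d i * pr A i y := by
  rw [form_sroot, pr_apply]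

theorem pr_self (C : Car n d A) (i : Fin n) : pr A i (sroot n i) = 2 := by
  rw [pr_sroot, C.hdiag]; norm_num

theorem s_self (C : Car n d A) (i : Fin n) :
    simpleRefl n d A i (sroot n i) = - sroot n i := by
  rw [s_apply C, pr_self C, two_smul]; abel

theorem s_s (C : Car n d A) (i : Fin n) (x : Fin n → ℝ) :
    simpleRefl n d A i (simpleRefl n d A i x) = x := by
  rw [s_apply C i x, map_sub, map_smul, s_self C, s_apply C]
  simp

theorem s_mul_s (C : Car n d A) (i : Fin n) :
    simpleRefl n d A i * simpleRefl n d A i = 1 := by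
  ext1 x; ext1; simp [s_s C]

theorem form_s (C : Car n d A) (i : Fin n) (x y : Fin n → ℝ) :
    formL n d A (simpleRefl n d A i x) (simpleRefl n d A i y) = formL n d A x y := by
  rw [s_apply C, s_apply C]
  simp only [map_sub, map_smul, LinearMap.sub_apply, LinearMap.smul_apply, smul_eq_mul]
  rw [form_symm C x (sroot n i), form_sroot', form_sroot', form_sroot', pr_self C]
  ring

theorem w_nil : wprod n d A [] = 1 := by simp [wprod]

theorem w_append (l m : List (Fin n)) : wprod n d A (l ++ m) = wprod n d A m * wprod n d A l := by
  simp [wprod]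

theorem w_cons (i : Fin n) (m : List (Fin n)) :
    wprod n d A (i :: m) = wprod n d A m * simpleRefl n d A i := by
  simp [wprod]

theorem w_single (i : Fin n) : wprod n d A [i] = simpleRefl n d A i := by
  simp [wprod]

theorem w_snoc (i : Fin n) (m : List (Fin n)) :
    wprod n d A (m ++ [i]) = simpleRefl n d A i * wprod n d A m := by
  simp [wprod]

theorem w_rev (C : Car n d A) (l : List (Fin n)) :
    wprod n d A l.reverse * wprod n d A l = 1 := by
  induction l with
  | nil => simp [w_nil]
  | cons i l ih =>
    rw [List.reverse_cons, w_snoc, w_cons, mul_assoc, ← mul_assoc _ _ (simpleRefl n d A i), ih,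
      one_mul, s_mul_s C]

/-- word equivalence, including parity -/
def WE (n : ℕ) (d : Fin n → ℤ) (A : Fin n → Fin n → ℤ) (l m : List (Fin n)) : Prop :=
  wprod n d A l = wprod n d A m ∧ l.length % 2 = m.length % 2

/-- reduced words -/
def Red (n : ℕ) (d : Fin n → ℤ) (A : Fin n → Fin n → ℤ) (l : List (Fin n)) : Prop :=
  ∀ m, WE n d A l m → l.length ≤ m.length

theorem WE.app {l m l' m' : List (Fin n)} (h : WE n d A l m) (h' : WE n d A l' m') :
    WE n d A (l ++ l') (m ++ m') := by
  refine ⟨by rw [w_append, w_append, h.1, h'.1], ?_⟩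
  have h1 := h.2
  have h2 := h'.2
  simp only [List.length_append]; omega

theorem WE.rfl' (l : List (Fin n)) : WE n d A l l := ⟨rfl, rfl⟩

theorem WE.symm' {l m : List (Fin n)} (h : WE n d A l m) : WE n d A m l := ⟨h.1.symm, h.2.symm⟩

theorem WE.trans' {l m k : List (Fin n)} (h : WE n d A l m) (h' : WE n d A m k) :
    WE n d A l k := ⟨h.1.trans h'.1, h.2.trans h'.2⟩

theorem Red.left {l m : List (Fin n)} (h : Red n d A (l ++ m)) : Red n d A l := by
  intro k hk
  have := h _ (hk.app (WE.rfl' m))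
  simp only [List.length_append] at this; omega

theorem Red.right {l m : List (Fin n)} (h : Red n d A (l ++ m)) : Red n d A m := by
  intro k hk
  have := h _ ((WE.rfl' l).app hk)
  simp only [List.length_append] at this; omega

theorem Red.tail {i : Fin n} {m : List (Fin n)} (h : Red n d A (i :: m)) : Red n d A m :=
  Red.right (l := [i]) h

theorem Red.of_WE {l m : List (Fin n)} (h : Red n d A l) (e : WE n d A l m)
    (hl : m.length ≤ l.length) : Red n d A m := by
  intro k hk
  exact hl.trans (h k (e.trans' hk))

theorem not_Red {l : List (Fin n)} (h : ¬ Red n d A l) :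
    ∃ m, WE n d A l m ∧ m.length + 2 ≤ l.length := by
  simp only [Red, not_forall] at h
  obtain ⟨m, e, hm⟩ := h
  refine ⟨m, e, ?_⟩
  have := e.2
  omega

theorem WE_ss (C : Car n d A) (i : Fin n) : WE n d A [i, i] [] := by
  refine ⟨?_, by simp⟩
  rw [w_cons, w_single, s_mul_s C, w_nil]

theorem exists_Red (l : List (Fin n)) : ∃ m, WE n d A l m ∧ Red n d A m := by
  by_contra hcon
  push Not at hcon
  have : ∀ N, ∀ m, WE n d A l m → N ≤ m.length := by
    intro N
    induction N with
    | zero => intros; omega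
    | succ N ih =>
      intro m hm
      obtain ⟨k, hk, hlt⟩ := not_Red (hcon m hm)
      have := ih k (hm.trans' hk)
      omega
  have := this (l.length + 1) l (WE.rfl' l)
  omega

/-- alternating words -/
def alt (a b : Fin n) : ℕ → List (Fin n)
  | 0 => []
  | N + 1 => a :: alt b a N

theorem alt_length (N : ℕ) : ∀ a b : Fin n, (alt a b N).length = N := by
  induction N with
  | zero => intros; rfl
  | succ N ih => intro a b; simp [alt, ih]

theorem alt_prefix (M : ℕ) : ∀ (a b : Fin n) (N : ℕ), M ≤ N → ∃ r, alt a b N = alt a b M ++ r := by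
  induction M with
  | zero => intro a b N _; exact ⟨_, rfl⟩
  | succ M ih =>
    intro a b N h
    obtain ⟨N, rfl⟩ : ∃ K, N = K + 1 := ⟨N - 1, by omega⟩
    obtain ⟨r, hr⟩ := ih b a N (by omega)
    exact ⟨r, by simp [alt, hr]⟩

theorem eq_alt (C : Car n d A) (m : List (Fin n)) : ∀ s t : Fin n, Red n d A (s :: m) →
    (∀ x ∈ m, x = s ∨ x = t) → m = alt t s m.length := by
  induction m with
  | nil => intros; rfl
  | cons x m ih =>
    intro s t hr hm
    have hx : x ≠ s := by
      rintro rfl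
      have := Red.left (l := [x, x]) (m := m) hr _ (WE_ss C x)
      simp at this
    have hx' : x = t := (hm x (by simp)).resolve_left hx
    subst hx'
    have := ih x s hr.tail (fun y hy => (hm y (by simp [hy])).symm)
    rw [List.length_cons, alt, ← this]

theorem s_comb (C : Car n d A) (s t : Fin n) (x : Fin n → ℝ) (u v : ℝ) :
    simpleRefl n d A s (x + u • sroot n s + v • sroot n t) =
      x + (-u - pr A s x - A s t * v) • sroot n s + v • sroot n t := by
  rw [s_apply C]
  simp only [map_add, map_smul, pr_self C, pr_sroot, smul_eq_mul]
  module

theorem s_comb' (C : Car n d A) (s t : Fin n) (x : Fin n → ℝ) (u v : ℝ) :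
    simpleRefl n d A t (x + u • sroot n s + v • sroot n t) =
      x + u • sroot n s + (-v - pr A t x - A t s * u) • sroot n t := by
  rw [s_apply C]
  simp only [map_add, map_smul, pr_self C, pr_sroot, smul_eq_mul]
  module

theorem s_pq (C : Car n d A) (s t : Fin n) (u v : ℝ) :
    simpleRefl n d A s (u • sroot n s + v • sroot n t) =
      (-u - A s t * v) • sroot n s + v • sroot n t := by
  have := s_comb C s t 0 u v
  simpa using this

theorem s_pq' (C : Car n d A) (s t : Fin n) (u v : ℝ) :
    simpleRefl n d A t (u • sroot n s + v • sroot n t) =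
      u • sroot n s + (-v - A t s * u) • sroot n t := by
  have := s_comb' C s t 0 u v
  simpa using this

theorem big (C : Car n d A) (N : ℕ) : ∀ (s t : Fin n) (p q : ℝ), s ≠ t → 4 ≤ A s t * A t s →
    0 ≤ p → 0 ≤ q → - A s t * q ≤ 2 * p →
    ∃ p' q' : ℝ, 0 ≤ p' ∧ 0 ≤ q' ∧ wprod n d A (alt t s N) (p • sroot n s + q • sroot n t)
      = p' • sroot n s + q' • sroot n t := by
  induction N with
  | zero => intro s t p q _ _ hp hq _; exact ⟨p, q, hp, hq, by simp [alt, w_nil]⟩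
  | succ N ih =>
    intro s t p q hst h4 hp hq h
    have h4' : (4 : ℝ) ≤ A s t * A t s := by exact_mod_cast h4
    have ha : (A s t : ℝ) ≤ 0 := by exact_mod_cast C.hoff s t hst
    have hb : (A t s : ℝ) ≤ 0 := by exact_mod_cast C.hoff t s hst.symm
    have key : 2 * q ≤ - A t s * p := by
      have h1 := mul_le_mul_of_nonneg_left h (neg_nonneg.2 hb)
      have h2 := mul_le_mul_of_nonneg_right h4' hq
      nlinarith
    obtain ⟨p', q', h1, h2, h3⟩ := ih t s (-q - A t s * p) p hst.symm (by rw [mul_comm]; exact h4)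
      (by linarith) hp (by linarith)
    refine ⟨q', p', h2, h1, ?_⟩
    rw [alt, w_cons, Module.End.mul_apply, s_pq' C, add_comm (p • _), h3, add_comm]

theorem braid_red (k : ℕ) (s t : Fin n) (r : List (Fin n))
    (h : WE n d A (alt s t (k + 1)) r) (hr : r.length < k + 1) (N : ℕ) (hN : k ≤ N) :
    ¬ Red n d A (s :: alt t s N) := by
  intro hred
  obtain ⟨r', hr'⟩ := alt_prefix (k + 1) s t (N + 1) (by omega)
  rw [alt] at hr'
  rw [hr'] at hred
  have := hred.left _ h
  rw [alt_length] at this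
  omega

theorem cases_ab (a b : ℤ) (ha : a ≤ 0) (hb : b ≤ 0) (h0 : a = 0 ↔ b = 0) (h : a * b < 4) :
    (a = 0 ∧ b = 0) ∨ (a = -1 ∧ b = -1) ∨ (a = -1 ∧ b = -2) ∨ (a = -2 ∧ b = -1) ∨
    (a = -1 ∧ b = -3) ∨ (a = -3 ∧ b = -1) := by
  by_cases h1 : a = 0
  · exact Or.inl ⟨h1, h0.1 h1⟩
  · have h2 : b ≠ 0 := fun h => h1 (h0.2 h)
    have ha' : -4 < a := by nlinarith [show b ≤ -1 by omega]
    have hb' : -4 < b := by nlinarith [show a ≤ -1 by omega]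
    have ha1 : a ≤ -1 := by omega
    have hb1 : b ≤ -1 := by omega
    interval_cases a <;> interval_cases b <;> simp_all

theorem braid_gen (C : Car n d A) (s t : Fin n) (l r : List (Fin n))
    (h : ∀ x, wprod n d A l (x + (0 : ℝ) • sroot n s + (0 : ℝ) • sroot n t) =
      wprod n d A r (x + (0 : ℝ) • sroot n s + (0 : ℝ) • sroot n t))
    (h2 : l.length % 2 = r.length % 2) : WE n d A l r := by
  refine ⟨LinearMap.ext fun x => ?_, h2⟩
  simpa using h x

theorem rank2 (C : Car n d A) (s t : Fin n) (hst : s ≠ t) (N : ℕ)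
    (hred : Red n d A (s :: alt t s N)) :
    ∃ p q : ℝ, 0 ≤ p ∧ 0 ≤ q ∧ wprod n d A (alt t s N) (sroot n s)
      = p • sroot n s + q • sroot n t := by
  have e0 : sroot n s = (1 : ℝ) • sroot n s + (0 : ℝ) • sroot n t := by simp
  by_cases h4 : 4 ≤ A s t * A t s
  · obtain ⟨p, q, h⟩ := big C N s t 1 0 hst h4 (by norm_num) (by norm_num) (by norm_num)
    rw [← e0] at h
    exact ⟨p, q, h⟩
  have h0 : A s t = 0 ↔ A t s = 0 := by
    have h := C.hsym s t
    have h1 := (C.hd s).ne'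
    have h2 := (C.hd t).ne'
    constructor <;> intro h' <;> simp_all
  have hc := cases_ab _ _ (C.hoff s t hst) (C.hoff t s hst.symm) h0 (not_le.1 h4)
  obtain ⟨k, r, hk6, hr, hWE, hpos⟩ : ∃ (k : ℕ) (r : List (Fin n)), k ≤ 6 ∧ r.length < k + 1 ∧
      WE n d A (alt s t (k + 1)) r ∧ ∀ N < k, ∃ p q : ℝ, 0 ≤ p ∧ 0 ≤ q ∧
        wprod n d A (alt t s N) ((1 : ℝ) • sroot n s + (0 : ℝ) • sroot n t)
      = p • sroot n s + q • sroot n t := by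
    rcases hc with ⟨ha, hb⟩ | ⟨ha, hb⟩ | ⟨ha, hb⟩ | ⟨ha, hb⟩ | ⟨ha, hb⟩ | ⟨ha, hb⟩
    · refine ⟨2, alt t s 1, by norm_num, by simp [alt], braid_gen C s t _ _ ?_ (by simp [alt]), ?_⟩
      · intro x
        simp only [alt, w_cons, w_nil, one_mul, Module.End.mul_apply, s_comb C s t, s_comb' C s t, ha, hb]
        push_cast
        module
      · intro N hN
        interval_cases N <;>
        · simp only [alt, w_cons, w_nil, one_mul, Module.End.mul_apply, s_pq C s t, s_pq' C s t, ha, hb, Module.End.one_apply]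
          refine ⟨_, _, ?_, ?_, rfl⟩ <;> norm_num
    · refine ⟨3, alt t s 2, by norm_num, by simp [alt], braid_gen C s t _ _ ?_ (by simp [alt]), ?_⟩
      · intro x
        simp only [alt, w_cons, w_nil, one_mul, Module.End.mul_apply, s_comb C s t, s_comb' C s t, ha, hb]
        push_cast
        module
      · intro N hN
        interval_cases N <;>
        · simp only [alt, w_cons, w_nil, one_mul, Module.End.mul_apply, s_pq C s t, s_pq' C s t, ha, hb, Module.End.one_apply]
          refine ⟨_, _, ?_, ?_, rfl⟩ <;> norm_num
    · refine ⟨4, alt t s 3, by norm_num, by simp [alt], braid_gen C s t _ _ ?_ (by simp [alt]), ?_⟩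
      · intro x
        simp only [alt, w_cons, w_nil, one_mul, Module.End.mul_apply, s_comb C s t, s_comb' C s t, ha, hb]
        push_cast
        module
      · intro N hN
        interval_cases N <;>
        · simp only [alt, w_cons, w_nil, one_mul, Module.End.mul_apply, s_pq C s t, s_pq' C s t, ha, hb, Module.End.one_apply]
          refine ⟨_, _, ?_, ?_, rfl⟩ <;> norm_num
    · refine ⟨4, alt t s 3, by norm_num, by simp [alt], braid_gen C s t _ _ ?_ (by simp [alt]), ?_⟩
      · intro x
        simp only [alt, w_cons, w_nil, one_mul, Module.End.mul_apply, s_comb C s t, s_comb' C s t, ha, hb]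
        push_cast
        module
      · intro N hN
        interval_cases N <;>
        · simp only [alt, w_cons, w_nil, one_mul, Module.End.mul_apply, s_pq C s t, s_pq' C s t, ha, hb, Module.End.one_apply]
          refine ⟨_, _, ?_, ?_, rfl⟩ <;> norm_num
    · refine ⟨6, alt t s 5, by norm_num, by simp [alt], braid_gen C s t _ _ ?_ (by simp [alt]), ?_⟩
      · intro x
        simp only [alt, w_cons, w_nil, one_mul, Module.End.mul_apply, s_comb C s t, s_comb' C s t, ha, hb]
        push_cast
        module
      · intro N hN
        interval_cases N <;>
        · simp only [alt, w_cons, w_nil, one_mul, Module.End.mul_apply, s_pq C s t, s_pq' C s t, ha, hb, Module.End.one_apply]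
          refine ⟨_, _, ?_, ?_, rfl⟩ <;> norm_num
    · refine ⟨6, alt t s 5, by norm_num, by simp [alt], braid_gen C s t _ _ ?_ (by simp [alt]), ?_⟩
      · intro x
        simp only [alt, w_cons, w_nil, one_mul, Module.End.mul_apply, s_comb C s t, s_comb' C s t, ha, hb]
        push_cast
        module
      · intro N hN
        interval_cases N <;>
        · simp only [alt, w_cons, w_nil, one_mul, Module.End.mul_apply, s_pq C s t, s_pq' C s t, ha, hb, Module.End.one_apply]
          refine ⟨_, _, ?_, ?_, rfl⟩ <;> norm_num
  by_cases hN : k ≤ N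
  · exact absurd hred (braid_red k s t r hWE hr N hN)
  · have := hpos N (by omega)
    rwa [← e0] at this

theorem red_pos (C : Car n d A) : ∀ (M : ℕ) (l : List (Fin n)) (s : Fin n), l.length = M →
    Red n d A (s :: l) → ∀ k, 0 ≤ wprod n d A l (sroot n s) k := by
  intro M
  induction M using Nat.strong_induction_on with
  | _ M ih =>
  intro l s hM hred
  cases l with
  | nil =>
    intro k
    simp only [w_nil, Module.End.one_apply, sroot, Pi.single_apply]
    split_ifs <;> norm_num
  | cons t rest =>
  have hst : s ≠ t := by
    rintro rfl
    have := Red.left (l := [s, s]) (m := rest) hred _ (WE_ss C s)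
    simp at this
  set l := t :: rest with hl
  have hlred : Red n d A l := hred.tail
  let P : ℕ → Prop := fun N => ∃ m u : List (Fin n), (∀ x ∈ m, x = s ∨ x = t) ∧ u.length = N ∧
    WE n d A l (m ++ u) ∧ (m ++ u).length = l.length
  have hP : P rest.length := ⟨[t], rest, by simp, rfl, WE.rfl' _, rfl⟩
  classical
  have hex : ∃ N, P N := ⟨_, hP⟩
  obtain ⟨m, u, hm, hu, hwe, hlen⟩ := Nat.find_spec hex
  have hmin : ∀ N, P N → u.length ≤ N := fun N hN => hu ▸ Nat.find_min' hex hN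
  have hult : u.length < M := by
    have := hmin _ hP
    rw [← hM, hl, List.length_cons]; omega
  have hlen' : m.length + u.length = l.length := by rw [← hlen, List.length_append]
  have hx : ∀ x, (x = s ∨ x = t) → Red n d A (x :: u) := by
    intro x hx
    by_contra hnr
    obtain ⟨u', hu', hlt⟩ := not_Red hnr
    rw [List.length_cons] at hlt
    have e1 : WE n d A u (x :: u') := by
      have h1 : WE n d A ([x] ++ ([x] ++ u)) ([x] ++ u') := (WE.rfl' [x]).app hu'
      have h2 : WE n d A ([x, x] ++ u) ([] ++ u) := (WE_ss C x).app (WE.rfl' u)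
      exact h2.symm'.trans' h1
    have e2 : WE n d A l ((m ++ [x]) ++ u') := by
      have := hwe.trans' ((WE.rfl' m).app e1)
      simpa using this
    have h3 := hlred _ e2
    simp only [List.length_append, List.length_cons, List.length_nil] at h3
    have := hmin u'.length ⟨m ++ [x], u', by
      intro y hy
      rcases List.mem_append.1 hy with hy | hy
      · exact hm y hy
      · rw [List.mem_singleton.1 hy]; exact hx, rfl, e2, by
      simp only [List.length_append, List.length_cons, List.length_nil]; omega⟩
    omega
  have hs := ih u.length hult u s rfl (hx s (Or.inl rfl))
  have ht := ih u.length hult u t rfl (hx t (Or.inr rfl))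
  have hsm : Red n d A (s :: m) := by
    have : Red n d A ((s :: m) ++ u) := by
      refine hred.of_WE (m := [s] ++ (m ++ u)) ((WE.rfl' [s]).app hwe) ?_
      simp only [List.length_append, List.length_cons, List.length_nil]; omega
    exact this.left
  have halt := eq_alt C m s t hsm hm
  rw [halt] at hsm
  obtain ⟨p, q, hp, hq, hpq⟩ := rank2 C s t hst _ hsm
  rw [← halt] at hpq
  intro k
  rw [hwe.1, w_append, Module.End.mul_apply, hpq, map_add, map_smul, map_smul]
  simp only [Pi.add_apply, Pi.smul_apply, smul_eq_mul]
  have := hs k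
  have := ht k
  positivity

theorem dichotomy (C : Car n d A) (γ : Fin n → ℝ) (h : IsRoot n d A γ) :
    (∀ k, 0 ≤ γ k) ∨ (∀ k, γ k ≤ 0) := by
  obtain ⟨l0, s, rfl⟩ := h
  obtain ⟨l, hwe, hl⟩ := exists_Red (d := d) (A := A) l0
  rw [hwe.1]
  by_cases hr : Red n d A (s :: l)
  · exact Or.inl (red_pos C _ l s rfl hr)
  · right
    obtain ⟨l', h', hlt⟩ := not_Red hr
    rw [List.length_cons] at hlt
    have e1 : WE n d A l (s :: l') := by
      have h1 : WE n d A ([s] ++ ([s] ++ l)) ([s] ++ l') := (WE.rfl' [s]).app h'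
      have h2 : WE n d A ([s, s] ++ l) ([] ++ l) := (WE_ss C s).app (WE.rfl' l)
      exact h2.symm'.trans' h1
    have hr' : Red n d A (s :: l') := hl.of_WE e1 (by rw [List.length_cons]; omega)
    have := red_pos C _ l' s rfl hr'
    intro k
    rw [e1.1, w_cons, Module.End.mul_apply, s_self C, map_neg, Pi.neg_apply]
    linarith [this k]

theorem isRoot_sroot (i : Fin n) : IsRoot n d A (sroot n i) := ⟨[], i, by simp [w_nil]⟩

theorem IsRoot.s {γ : Fin n → ℝ} (h : IsRoot n d A γ) (i : Fin n) :
    IsRoot n d A (simpleRefl n d A i γ) := by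
  obtain ⟨l, j, rfl⟩ := h
  exact ⟨l ++ [i], j, by rw [w_snoc, Module.End.mul_apply]⟩

theorem IsRoot.neg (C : Car n d A) {γ : Fin n → ℝ} (h : IsRoot n d A γ) :
    IsRoot n d A (-γ) := by
  obtain ⟨l, j, rfl⟩ := h
  exact ⟨j :: l, j, by rw [w_cons, Module.End.mul_apply, s_self C, map_neg]⟩

theorem w_int (C : Car n d A) (l : List (Fin n)) : ∀ (x : Fin n → ℝ), (∀ k, ∃ z : ℤ, x k = z) →
    ∀ k, ∃ z : ℤ, wprod n d A l x k = z := by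
  induction l with
  | nil => intro x hx; simpa [w_nil] using hx
  | cons i l ih =>
    intro x hx
    rw [w_cons, Module.End.mul_apply]
    apply ih
    intro k
    choose z hz using hx
    refine ⟨z k - (∑ j, A i j * z j) * (if k = i then 1 else 0), ?_⟩
    rw [s_apply C, pr_apply]
    simp only [Pi.sub_apply, Pi.smul_apply, smul_eq_mul, hz, sroot, Pi.single_apply]
    push_cast
    rfl

theorem sroot_int (i : Fin n) : ∀ k, ∃ z : ℤ, sroot n i k = z := by
  intro k
  refine ⟨if k = i then 1 else 0, ?_⟩
  simp only [sroot, Pi.single_apply]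
  push_cast; rfl

theorem mult_eq (C : Car n d A) {γ : Fin n → ℝ} (h : IsPosRoot n d A γ) (i : Fin n)
    (hs : ∀ k, k ≠ i → γ k = 0) : γ = sroot n i := by
  obtain ⟨⟨l, j, hl⟩, hp⟩ := h
  have e : γ = γ i • sroot n i := by
    ext k
    by_cases hk : k = i
    · subst hk; simp [sroot]
    · simp [sroot, hk, hs k hk]
  obtain ⟨z, hz⟩ : ∃ z : ℤ, γ i = z := by rw [hl]; exact w_int C l _ (sroot_int j) i
  obtain ⟨y, hy⟩ := w_int C l.reverse _ (sroot_int i) j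
  have h1 : wprod n d A l.reverse γ = sroot n j := by
    rw [hl, ← Module.End.mul_apply, w_rev C]; rfl
  rw [e, map_smul] at h1
  have h2 := congrFun h1 j
  simp only [Pi.smul_apply, smul_eq_mul, hy, hz] at h2
  simp only [sroot, Pi.single_eq_same] at h2
  have h3 : z * y = 1 := by exact_mod_cast h2
  have h4 : 0 ≤ z := by
    have := hp i
    rw [hz] at this; exact_mod_cast this
  have h5 : z = 1 := by
    rcases Int.eq_one_or_neg_one_of_mul_eq_one h3 with h | h
    · exact h
    · omega
  rw [e, hz, h5]; simp

theorem pos_s (C : Car n d A) {γ : Fin n → ℝ} (h : IsPosRoot n d A γ) (i : Fin n)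
    (hne : γ ≠ sroot n i) : IsPosRoot n d A (simpleRefl n d A i γ) := by
  refine ⟨h.1.s i, ?_⟩
  rcases dichotomy C _ (h.1.s i) with h' | h'
  · exact h'
  · exfalso
    apply hne
    apply mult_eq C h
    intro k hk
    have h1 := h' k
    rw [s_apply C] at h1
    simp [sroot, hk] at h1
    exact le_antisymm h1 (h.2 k)

theorem pos_sroot (i : Fin n) : IsPosRoot n d A (sroot n i) := by
  refine ⟨isRoot_sroot i, fun k => ?_⟩
  simp only [sroot, Pi.single_apply]
  split_ifs <;> norm_num

theorem root_form (C : Car n d A) {γ : Fin n → ℝ} (h : IsRoot n d A γ) :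
    0 < formL n d A γ γ := by
  obtain ⟨l, j, rfl⟩ := h
  induction l using List.reverseRecOn with
  | nil =>
    rw [w_nil, Module.End.one_apply, form_sroot', pr_self C]
    have : (0 : ℝ) < d j := by exact_mod_cast C.hd j
    positivity
  | append_singleton l i ih =>
    rw [w_snoc, Module.End.mul_apply, form_s C]; exact ih

theorem root_ne (C : Car n d A) {γ : Fin n → ℝ} (h : IsRoot n d A γ) : γ ≠ 0 := by
  rintro rfl
  simpa using root_form C h

theorem not_both (C : Car n d A) {γ : Fin n → ℝ} (h : IsPosRoot n d A γ)
    (h' : IsPosRoot n d A (-γ)) : False := by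
  apply root_ne C h.1
  ext k
  have h1 := h.2 k
  have h2 := h'.2 k
  simp only [Pi.neg_apply] at h2
  simp only [Pi.zero_apply]
  linarith

theorem refl_apply (b x : Fin n → ℝ) :
    reflAlong n d A b x = x - (2 / formL n d A b b * formL n d A b x) • b := by
  simp [reflAlong, smul_smul]

theorem refl_conj (C : Car n d A) (i : Fin n) (b x : Fin n → ℝ) :
    reflAlong n d A (simpleRefl n d A i b) (simpleRefl n d A i x) =
      simpleRefl n d A i (reflAlong n d A b x) := by
  rw [refl_apply, refl_apply, form_s C, form_s C, map_sub, map_smul]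

theorem refl_refl (C : Car n d A) {b : Fin n → ℝ} (h : IsRoot n d A b) (x : Fin n → ℝ) :
    reflAlong n d A b (reflAlong n d A b x) = x := by
  have h0 := (root_form C h).ne'
  rw [refl_apply b x, refl_apply]
  simp only [map_sub, map_smul, smul_eq_mul]
  have : 2 / formL n d A b b * (formL n d A b x - 2 / formL n d A b b * formL n d A b x *
    formL n d A b b) = - (2 / formL n d A b b * formL n d A b x) := by
    field_simp; ring
  rw [this]; module

theorem refl_s (C : Car n d A) (i : Fin n) (x : Fin n → ℝ) :
    reflAlong n d A (sroot n i) x = simpleRefl n d A i x := by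
  have h : (d i : ℝ) ≠ 0 := by exact_mod_cast (C.hd i).ne'
  rw [refl_apply, s_apply C, form_sroot', form_sroot', pr_self C]
  congr 2
  field_simp

theorem refl_root (C : Car n d A) {b : Fin n → ℝ} (h : IsRoot n d A b) : ∀ {x : Fin n → ℝ},
    IsRoot n d A x → IsRoot n d A (reflAlong n d A b x) := by
  obtain ⟨l, j, rfl⟩ := h
  induction l using List.reverseRecOn with
  | nil =>
    intro x hx
    rw [w_nil, Module.End.one_apply, refl_s C]; exact hx.s j
  | append_singleton l i ih =>
    intro x hx
    rw [w_snoc, Module.End.mul_apply, ← s_s C i x, refl_conj C]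
    exact (ih (hx.s i)).s i

/-- membership in the list of the `δ`s -/
def InD (n : ℕ) (d : Fin n → ℤ) (A : Fin n → Fin n → ℤ) (l : List (Fin n))
    (γ : Fin n → ℝ) : Prop :=
  ∃ p i q, l = p ++ i :: q ∧ γ = wprod n d A q (sroot n i)

theorem inD_iff (l : List (Fin n)) (γ : Fin n → ℝ) :
    (∃ k : Fin l.length, γ = wprod n d A (l.drop (k.1 + 1)) (sroot n (l.get k))) ↔
      InD n d A l γ := by
  constructor
  · rintro ⟨k, hk⟩
    refine ⟨l.take k.1, l.get k, l.drop (k.1 + 1), ?_, hk⟩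
    simp
  · rintro ⟨p, i, q, rfl, h⟩
    refine ⟨⟨p.length, by simp⟩, ?_⟩
    simp [h, List.drop_append, List.drop_eq_nil_of_le]

theorem inD_nil (γ : Fin n → ℝ) : ¬ InD n d A [] γ := by
  rintro ⟨p, i, q, h, _⟩
  simp at h

theorem inD_snoc (C : Car n d A) (l : List (Fin n)) (i : Fin n) (γ : Fin n → ℝ) :
    InD n d A (l ++ [i]) γ ↔ γ = sroot n i ∨ InD n d A l (simpleRefl n d A i γ) := by
  constructor
  · rintro ⟨p, x, q, h, rfl⟩
    rcases List.eq_nil_or_concat q with rfl | ⟨q', y, rfl⟩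
    · left
      have := List.append_inj' h rfl
      simp only [List.cons.injEq, and_true] at this
      rw [w_nil, this.2]; rfl
    · right
      rw [List.concat_eq_append] at h ⊢
      rw [← List.cons_append, ← List.append_assoc] at h
      have := List.append_inj' h rfl
      simp only [List.cons.injEq, and_true] at this
      refine ⟨p, x, q', this.1, ?_⟩
      rw [← this.2, w_snoc, Module.End.mul_apply, s_s C]
  · rintro (rfl | ⟨p, x, q, rfl, h⟩)
    · exact ⟨l, i, [], rfl, by simp [w_nil]⟩
    · refine ⟨p, x, q ++ [i], by simp, ?_⟩
      rw [w_snoc, Module.End.mul_apply, ← h, s_s C]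

theorem posExpr_snoc {j : Fin n} {l : List (Fin n)} {i : Fin n}
    (h : IsPosExpr n d A j (l ++ [i])) : IsPosExpr n d A j l ∧
      ∃ c : ℝ, 0 < c ∧ simpleRefl n d A i (wprod n d A l (sroot n j)) - wprod n d A l (sroot n j)
        = c • sroot n i := by
  constructor
  · intro k
    obtain ⟨c, hc, h1⟩ := h ⟨k.1, by have := k.2; rw [List.length_append]; omega⟩
    refine ⟨c, hc, ?_⟩
    have hk := k.2
    rw [List.take_append_of_le_length (by dsimp only; omega), List.take_append_of_le_length (by dsimp only; omega)] at h1
    simpa using h1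
  · obtain ⟨c, hc, h1⟩ := h ⟨l.length, by simp⟩
    refine ⟨c, hc, ?_⟩
    simpa [w_snoc, List.take_append, List.take_of_length_le] using h1

theorem main_ind (C : Car n d A) (j : Fin n) (l : List (Fin n)) : IsPosExpr n d A j l →
    (∀ k, 0 ≤ wprod n d A l (sroot n j) k) ∧
    (∀ δ, InD n d A l δ → IsPosRoot n d A δ ∧
      IsPosRoot n d A (-reflAlong n d A (wprod n d A l (sroot n j)) δ)) ∧
    (∀ γ, IsPosRoot n d A γ → IsPosRoot n d A (-reflAlong n d A (wprod n d A l (sroot n j)) γ) →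
      γ ≠ wprod n d A l (sroot n j) →
      Xor' (InD n d A l γ) (InD n d A l (-reflAlong n d A (wprod n d A l (sroot n j)) γ))) := by
  induction l using List.reverseRecOn with
  | nil =>
    intro _
    rw [w_nil, Module.End.one_apply]
    refine ⟨(pos_sroot (d := d) (A := A) j).2, fun δ h => absurd h (inD_nil δ), ?_⟩
    intro γ h1 h2 h3
    rw [refl_s C] at h2
    exact (not_both C (pos_s C h1 j h3) h2).elim
  | append_singleton l i ih =>
    intro h
    obtain ⟨hl, c, hc, hci⟩ := posExpr_snoc h
    obtain ⟨hb, hD, hX⟩ := ih hl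
    rw [w_snoc, Module.End.mul_apply]
    have hroot : IsRoot n d A (wprod n d A l (sroot n j)) := ⟨l, j, rfl⟩
    generalize wprod n d A l (sroot n j) = b at *
    have hbb := root_form C hroot
    have hneg : pr A i b = -c := by
      rw [s_apply C] at hci
      have := congrFun hci i
      simp [sroot] at this
      linarith
    have hneg' : formL n d A b (sroot n i) < 0 := by
      rw [form_symm C, form_sroot', hneg]
      have : (0 : ℝ) < d i := by exact_mod_cast C.hd i
      nlinarith
    have hcoef : 2 / formL n d A b b * formL n d A b (sroot n i) < 0 :=
      mul_neg_of_pos_of_neg (by positivity) hneg'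
    -- the reflected simple root is positive
    have hT : IsPosRoot n d A (reflAlong n d A b (sroot n i)) := by
      refine ⟨refl_root C hroot (isRoot_sroot i), fun k => ?_⟩
      rw [refl_apply]
      simp only [Pi.sub_apply, Pi.smul_apply, smul_eq_mul]
      have h1 := (pos_sroot (d := d) (A := A) i).2 k
      have h2 := hb k
      nlinarith
    have hTne : reflAlong n d A b (sroot n i) ≠ sroot n i := by
      intro he
      rw [refl_apply, sub_eq_self, smul_eq_zero] at he
      rcases he with he | he
      · linarith
      · exact root_ne C hroot he
    have hconj : ∀ x, reflAlong n d A (simpleRefl n d A i b) x =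
        simpleRefl n d A i (reflAlong n d A b (simpleRefl n d A i x)) := by
      intro x
      rw [← refl_conj C, s_s C]
    have hsT : -reflAlong n d A (simpleRefl n d A i b) (sroot n i) =
        simpleRefl n d A i (reflAlong n d A b (sroot n i)) := by
      rw [hconj, s_self C, map_neg, map_neg, neg_neg]
    have hnotD : ¬ InD n d A (l ++ [i]) (simpleRefl n d A i (reflAlong n d A b (sroot n i))) := by
      rw [inD_snoc C, s_s C]
      rintro (h1 | h1)
      · have h2 := congrArg (simpleRefl n d A i) h1
        rw [s_s C, s_self C] at h2
        rw [h2] at hT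
        exact not_both C (pos_sroot i) hT
      · have h2 := (hD _ h1).2
        rw [refl_refl C hroot] at h2
        exact not_both C (pos_sroot i) h2
    refine ⟨?_, ?_, ?_⟩
    · intro k
      have e : simpleRefl n d A i b = b + c • sroot n i := by rw [← hci]; abel
      rw [e]
      have h1 := (pos_sroot (d := d) (A := A) i).2 k
      have h2 := hb k
      simp only [Pi.add_apply, Pi.smul_apply, smul_eq_mul]
      positivity
    · intro δ hδ
      rcases (inD_snoc C l i δ).1 hδ with rfl | h1
      · refine ⟨pos_sroot i, ?_⟩
        rw [hsT]
        exact pos_s C hT i hTne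
      · obtain ⟨h2, h3⟩ := hD _ h1
        constructor
        · rw [← s_s C i δ]
          refine pos_s C h2 i ?_
          intro he
          rw [he] at h3
          exact not_both C hT h3
        · rw [hconj, ← map_neg]
          refine pos_s C h3 i ?_
          intro he
          have h4 := congrArg (reflAlong n d A b) he
          rw [map_neg, refl_refl C hroot] at h4
          rw [← h4] at hT
          exact not_both C h2 hT
    · intro γ h1 h2 h3
      by_cases hg : γ = sroot n i
      · subst hg
        rw [hsT]
        exact Or.inl ⟨(inD_snoc C l i _).2 (Or.inl rfl), hnotD⟩
      by_cases hg' : -reflAlong n d A (simpleRefl n d A i b) γ = sroot n i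
      · have hroot' := hroot.s i
        have : γ = simpleRefl n d A i (reflAlong n d A b (sroot n i)) := by
          rw [← hsT, ← hg', map_neg, refl_refl C hroot', neg_neg]
        rw [hg']
        refine Or.inr ⟨(inD_snoc C l i _).2 (Or.inl rfl), ?_⟩
        rw [this]; exact hnotD
      · have h4 := pos_s C h1 i hg
        have h5 := pos_s C h2 i hg'
        have e : simpleRefl n d A i (-reflAlong n d A (simpleRefl n d A i b) γ) =
            -reflAlong n d A b (simpleRefl n d A i γ) := by
          rw [hconj, map_neg, s_s C]
        rw [e] at h5
        have := hX _ h4 h5 (by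
          intro he
          apply h3
          rw [← he, s_s C])
        rw [inD_snoc C, inD_snoc C, e]
        simpa only [hg, hg', false_or] using this

end aux

/-- for a positive expression `β = s i_r ⋯ s i_1 (α j)` with
`δ_k = s i_r ⋯ s i_{k+1} (α i_k)`, any inversion `γ ≠ β` of `t_β` satisfies
that exactly one of `γ` and `-t_β γ` occurs among the `δ_k`.
(Here `k : Fin l.length` is the zero-based version of the one-based index `k+1`,
so `δ_{k+1} = wprod (l.drop (k+1)) (α (l.get k))`.) -/
theorem stmt5 (n : ℕ) (hn : 1 ≤ n) (d : Fin n → ℤ) (A : Fin n → Fin n → ℤ)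
    (hd : ∀ i, 0 < d i) (hdiag : ∀ i, A i i = 2)
    (hoff : ∀ i j, i ≠ j → A i j ≤ 0)
    (hsym : ∀ i j, d i * A i j = d j * A j i)
    (j : Fin n) (l : List (Fin n)) (hl : IsPosExpr n d A j l)
    (β : Fin n → ℝ) (hβ : β = wprod n d A l (sroot n j))
    (γ : Fin n → ℝ) (hγ : γ ∈ invSet n d A β) (hne : γ ≠ β) :
    Xor'
      (∃ k : Fin l.length, γ = wprod n d A (l.drop (k.1 + 1)) (sroot n (l.get k)))
      (∃ k : Fin l.length,
        -(reflAlong n d A β γ) = wprod n d A (l.drop (k.1 + 1)) (sroot n (l.get k))) := by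
  have C : Car n d A := ⟨hd, hdiag, hoff, hsym⟩
  rw [inD_iff, inD_iff]
  subst hβ
  refine (main_ind C j l hl).2.2 γ hγ.1 ⟨hγ.2.1.neg C, fun k => ?_⟩ hne
  have := hγ.2.2 k
  simp only [Pi.neg_apply]
  linarith

end
end
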